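/- Let n ≥ 2, q ≥ 2, and γ ≥ 0 with γ + 2 ∈ [0,q]. Assume f : ℝⁿ → [0,∞) is measurable with ∫_{ℝⁿ} f(v) dv ≤ M₀ and ∫_{ℝⁿ} f(v) |v|^q dv ≤ M_q. Then there exists Λ > 0, depending only on n, M₀, M_q, q (independent of v₀), such that for every v₀ ∈ ℝⁿ and every v in the ball B₂ of radius 2 centered at the origin: (a) sup_{e ∈ S^{n-1}} e · Ã(v) e ≤ Λ; (b) |b̃(v)| ≤ Λ; and (c) |c̃(v)| ≤ Λ (1 + |v₀|)^{−2}, where Ã, b̃, c̃ are the transformed Landau coefficients associated to f and v₀. -/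

import Mathlib

open MeasureTheory Metric Set
open scoped ENNReal RealInnerProductSpace NNReal

noncomputable section

/-- `ℝⁿ` -/
abbrev En (n : ℕ) := EuclideanSpace ℝ (Fin n)

/-- The mean velocity `v̄ = (∫ f v dv) / (∫ f dv)`. -/
def vbar {n : ℕ} (f : En n → ℝ) : En n := (∫ v, f v)⁻¹ • ∫ v, f v • v

/-- Mass bounds `m₀ ≤ ∫ f ≤ M₀`. -/
def MassBound {n : ℕ} (f : En n → ℝ) (m₀ M₀ : ℝ) : Prop :=
  ENNReal.ofReal m₀ ≤ (∫⁻ v, ENNReal.ofReal (f v)) ∧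
    (∫⁻ v, ENNReal.ofReal (f v)) ≤ ENNReal.ofReal M₀

/-- Pressure lower bound:
`inf_{σ ∈ S^{n-1}} sup_{e ∈ S^{n-1}, e ⊥ σ} ∫ f(v̄+w) |w·e|² dw ≥ p₀`,
written via the ε-characterization of the supremum. -/
def PressureLB {n : ℕ} (f : En n → ℝ) (p₀ : ℝ) : Prop :=
  ∀ σ : En n, ‖σ‖ = 1 → ∀ ε : ℝ, 0 < ε → ∃ e : En n, ‖e‖ = 1 ∧ ⟪e, σ⟫ = 0 ∧
    ENNReal.ofReal (p₀ - ε) ≤ ∫⁻ w, ENNReal.ofReal (f (vbar f + w) * ⟪w, e⟫ ^ 2)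

/-- Moment bound `∫ f(v) |v|^q dv ≤ M_q`. -/
def MomentBound {n : ℕ} (f : En n → ℝ) (q Mq : ℝ) : Prop :=
  (∫⁻ v, ENNReal.ofReal (f v * ‖v‖ ^ q)) ≤ ENNReal.ofReal Mq

/-- The change of variables `τ₀`: for `|v₀| ≥ 2` it maps `a v₀ + w ↦ (a/|v₀|) v₀ + w`
(for `w ⊥ v₀`); for `|v₀| < 2` it is the identity. -/
def tau0 {n : ℕ} (v₀ : En n) (u : En n) : En n :=
  if 2 ≤ ‖v₀‖ then u + ((1 / ‖v₀‖ - 1) * (⟪u, v₀⟫ / ‖v₀‖ ^ 2)) • v₀ else u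

/-- The inverse `τ₀⁻¹` of `τ₀`: for `|v₀| ≥ 2` it maps `a v₀ + w ↦ (a|v₀|) v₀/|v₀| ⋯`,
i.e. `a v₀ + w ↦ a‖v₀‖ v₀ + w` in the decomposition `u = a v₀ + w` with `w ⊥ v₀`;
for `|v₀| < 2` it is the identity. -/
def tau0inv {n : ℕ} (v₀ : En n) (u : En n) : En n :=
  if 2 ≤ ‖v₀‖ then u + ((‖v₀‖ - 1) * (⟪u, v₀⟫ / ‖v₀‖ ^ 2)) • v₀ else u

/-- The quadratic form of the Landau diffusion matrix
`A(v) = ∫ (I - ŵ⊗ŵ) |w|^{γ+2} f(v-w) dw` (with the dimensional constant normalized to `1`),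
evaluated at a vector `a`:
`a·A(v)a = ∫ (|a|² - (w·a)²/|w|²) |w|^{γ+2} f(v-w) dw`, valued in `[0,∞]`. -/
def landauQF (n : ℕ) (γ : ℝ) (f : En n → ℝ) (v a : En n) : ℝ≥0∞ :=
  ∫⁻ w, ENNReal.ofReal ((‖a‖ ^ 2 - ⟪w, a⟫ ^ 2 / ‖w‖ ^ 2) * ‖w‖ ^ (γ + 2) * f (v - w))

/-- The quadratic form `e·Ã(v)e` of the transformed Landau diffusion matrix
`Ã(v)e = |v₀|^{-γ-2} τ₀⁻¹(A(v₀+τ₀(v)) τ₀⁻¹(e))` for `|v₀| ≥ 2` (using that `τ₀⁻¹` is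
self-adjoint, `e·Ã(v)e = |v₀|^{-γ-2} (τ₀⁻¹e)·A(v₀+τ₀(v))(τ₀⁻¹e)`), and
`Ã(v) = A(v₀+v)` for `|v₀| < 2`. -/
def landauQFtilde (n : ℕ) (γ : ℝ) (f : En n → ℝ) (v₀ v e : En n) : ℝ≥0∞ :=
  if 2 ≤ ‖v₀‖ then
    ENNReal.ofReal (‖v₀‖ ^ (-γ - 2)) * landauQF n γ f (v₀ + tau0 v₀ v) (tau0inv v₀ e)
  else landauQF n γ f (v₀ + v) e

/-- The Landau drift coefficient `b(v) = ∫ w |w|^γ f(v-w) dw` (dimensional constant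
normalized to `1`). -/
def landauB (n : ℕ) (γ : ℝ) (f : En n → ℝ) (v : En n) : En n :=
  ∫ w, (‖w‖ ^ γ * f (v - w)) • w

/-- The transformed Landau drift `b̃(v) = |v₀|^{-γ-2} τ₀⁻¹(b(v₀+τ₀(v)))` for `|v₀| ≥ 2`, and
`b̃(v) = b(v₀+v)` for `|v₀| < 2`. -/
def landauBtilde (n : ℕ) (γ : ℝ) (f : En n → ℝ) (v₀ v : En n) : En n :=
  if 2 ≤ ‖v₀‖ then ‖v₀‖ ^ (-γ - 2) • tau0inv v₀ (landauB n γ f (v₀ + tau0 v₀ v))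
  else landauB n γ f (v₀ + v)

/-- The Landau zeroth-order coefficient `c(v) = ∫ |w|^γ f(v-w) dw`, valued in `[0,∞]`
(dimensional constant normalized to `1`). -/
def landauC (n : ℕ) (γ : ℝ) (f : En n → ℝ) (v : En n) : ℝ≥0∞ :=
  ∫⁻ w, ENNReal.ofReal (‖w‖ ^ γ * f (v - w))

/-- The transformed Landau zeroth-order coefficient `c̃(v) = |v₀|^{-γ-2} c(v₀+τ₀(v))` for
`|v₀| ≥ 2`, and `c̃(v) = c(v₀+v)` for `|v₀| < 2`. -/
def landauCtilde (n : ℕ) (γ : ℝ) (f : En n → ℝ) (v₀ v : En n) : ℝ≥0∞ :=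
  if 2 ≤ ‖v₀‖ then ENNReal.ofReal (‖v₀‖ ^ (-γ - 2)) * landauC n γ f (v₀ + tau0 v₀ v)
  else landauC n γ f (v₀ + v)

lemma four_add_rpow_le {q : ℝ} (hq : 0 ≤ q) {x : ℝ} (hx : 0 ≤ x) :
    (4 + x) ^ q ≤ 8 ^ q * (1 + x ^ q) := by
  have h8 : (0 : ℝ) ≤ 8 ^ q := by positivity
  have hxq : 0 ≤ x ^ q := by positivity
  rcases le_total x 4 with h | h
  · calc (4 + x) ^ q ≤ 8 ^ q := Real.rpow_le_rpow (by positivity) (by linarith) hq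
      _ ≤ 8 ^ q * (1 + x ^ q) := le_mul_of_one_le_right h8 (by linarith)
  · calc (4 + x) ^ q ≤ (8 * x) ^ q := Real.rpow_le_rpow (by positivity) (by linarith) hq
      _ = 8 ^ q * x ^ q := Real.mul_rpow (by norm_num) hx
      _ ≤ 8 ^ q * (1 + x ^ q) := by gcongr; linarith

/-- A weighted mass bound: it controls every kernel of growth at most `(4 + |v|)^q`. -/
def momentConst (q M₀ Mq : ℝ) : ℝ := 8 ^ q * (max M₀ 0 + max Mq 0)

lemma momentConst_nonneg (q M₀ Mq : ℝ) : 0 ≤ momentConst q M₀ Mq := by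
  unfold momentConst; positivity

section Moments

variable {n : ℕ} {q M₀ Mq : ℝ} {f : En n → ℝ}

lemma lintegral_four_add_rpow_mul_le (hq : 0 ≤ q) (hfm : Measurable f) (hf : ∀ v, 0 ≤ f v)
    (hM₀ : (∫⁻ v, ENNReal.ofReal (f v)) ≤ ENNReal.ofReal M₀) (hMq : MomentBound f q Mq) :
    (∫⁻ v, ENNReal.ofReal ((4 + ‖v‖) ^ q * f v)) ≤ ENNReal.ofReal (momentConst q M₀ Mq) := by
  have h8 : (0 : ℝ) ≤ 8 ^ q := by positivity
  calc (∫⁻ v, ENNReal.ofReal ((4 + ‖v‖) ^ q * f v))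
      ≤ ∫⁻ v, ENNReal.ofReal (8 ^ q) *
          (ENNReal.ofReal (f v) + ENNReal.ofReal (f v * ‖v‖ ^ q)) := by
        refine lintegral_mono fun v ↦ ?_
        have hv := hf v
        rw [← ENNReal.ofReal_add hv (by positivity), ← ENNReal.ofReal_mul h8]
        apply ENNReal.ofReal_le_ofReal
        calc (4 + ‖v‖) ^ q * f v ≤ 8 ^ q * (1 + ‖v‖ ^ q) * f v :=
              mul_le_mul_of_nonneg_right (four_add_rpow_le hq (norm_nonneg v)) hv
          _ = 8 ^ q * (f v + f v * ‖v‖ ^ q) := by ring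
    _ = ENNReal.ofReal (8 ^ q) *
          ((∫⁻ v, ENNReal.ofReal (f v)) + ∫⁻ v, ENNReal.ofReal (f v * ‖v‖ ^ q)) := by
        rw [lintegral_const_mul' _ _ ENNReal.ofReal_ne_top,
          lintegral_add_left hfm.ennreal_ofReal]
    _ ≤ ENNReal.ofReal (8 ^ q) *
          (ENNReal.ofReal (max M₀ 0) + ENNReal.ofReal (max Mq 0)) := by
        gcongr
        · exact hM₀.trans (ENNReal.ofReal_le_ofReal (le_max_left _ _))
        · exact hMq.trans (ENNReal.ofReal_le_ofReal (le_max_left _ _))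
    _ = ENNReal.ofReal (momentConst q M₀ Mq) := by
        rw [← ENNReal.ofReal_add (le_max_right _ _) (le_max_right _ _), ← ENNReal.ofReal_mul h8,
          momentConst]

lemma lintegral_kernel_mul_le (hq : 0 ≤ q) (hfm : Measurable f) (hf : ∀ v, 0 ≤ f v)
    (hM₀ : (∫⁻ v, ENNReal.ofReal (f v)) ≤ ENNReal.ofReal M₀) (hMq : MomentBound f q Mq)
    {C : ℝ} (hC : 0 ≤ C) (V : En n) {g : En n → ℝ}
    (hg : ∀ w, g w ≤ C * (4 + ‖V - w‖) ^ q) :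
    (∫⁻ w, ENNReal.ofReal (g w * f (V - w))) ≤ ENNReal.ofReal (C * momentConst q M₀ Mq) := by
  calc (∫⁻ w, ENNReal.ofReal (g w * f (V - w)))
      ≤ ∫⁻ w, ENNReal.ofReal C * ENNReal.ofReal ((4 + ‖V - w‖) ^ q * f (V - w)) := by
        refine lintegral_mono fun w ↦ ?_
        rw [← ENNReal.ofReal_mul hC, ← mul_assoc]
        exact ENNReal.ofReal_le_ofReal (mul_le_mul_of_nonneg_right (hg w) (hf _))
    _ = ENNReal.ofReal C * ∫⁻ v, ENNReal.ofReal ((4 + ‖v‖) ^ q * f v) := by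
        rw [lintegral_const_mul' _ _ ENNReal.ofReal_ne_top,
          lintegral_sub_left_eq_self (fun v ↦ ENNReal.ofReal ((4 + ‖v‖) ^ q * f v)) V]
    _ ≤ ENNReal.ofReal C * ENNReal.ofReal (momentConst q M₀ Mq) := by
        gcongr
        exact lintegral_four_add_rpow_mul_le hq hfm hf hM₀ hMq
    _ = ENNReal.ofReal (C * momentConst q M₀ Mq) := (ENNReal.ofReal_mul hC).symm

lemma norm_rpow_le_of_norm_le {V : En n} {ρ s : ℝ} (hρ : 1 ≤ ρ) (hV : ‖V‖ ≤ 4 * ρ)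
    (hs : 0 ≤ s) (w : En n) : ‖w‖ ^ s ≤ ρ ^ s * (4 + ‖V - w‖) ^ s := by
  rw [← Real.mul_rpow (by linarith) (by positivity)]
  refine Real.rpow_le_rpow (norm_nonneg _) ?_ hs
  have h1 : ‖w‖ ≤ ‖V‖ + ‖V - w‖ := by
    simpa using norm_sub_le V (V - w)
  nlinarith [norm_nonneg (V - w)]

lemma norm_rpow_le_mul_four_add_rpow {V : En n} {ρ s : ℝ} (hρ : 1 ≤ ρ) (hV : ‖V‖ ≤ 4 * ρ)
    (hs : 0 ≤ s) (hsq : s ≤ q) (w : En n) : ‖w‖ ^ s ≤ ρ ^ s * (4 + ‖V - w‖) ^ q := by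
  have h1 : (4 + ‖V - w‖) ^ s ≤ (4 + ‖V - w‖) ^ q :=
    Real.rpow_le_rpow_of_exponent_le (by linarith [norm_nonneg (V - w)]) hsq
  have h2 : 0 ≤ ρ ^ s := Real.rpow_nonneg (by linarith) _
  exact (norm_rpow_le_of_norm_le hρ hV hs w).trans (mul_le_mul_of_nonneg_left h1 h2)

variable {γ ρ : ℝ} {V : En n}

lemma landauC_le (hγ : 0 ≤ γ) (hγq : γ + 2 ≤ q) (hfm : Measurable f) (hf : ∀ v, 0 ≤ f v)
    (hM₀ : (∫⁻ v, ENNReal.ofReal (f v)) ≤ ENNReal.ofReal M₀) (hMq : MomentBound f q Mq)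
    (hρ : 1 ≤ ρ) (hV : ‖V‖ ≤ 4 * ρ) :
    landauC n γ f V ≤ ENNReal.ofReal (ρ ^ γ * momentConst q M₀ Mq) :=
  lintegral_kernel_mul_le (by linarith) hfm hf hM₀ hMq (Real.rpow_nonneg (by linarith) _) V
    fun w ↦ norm_rpow_le_mul_four_add_rpow hρ hV hγ (by linarith) w

lemma norm_landauB_le (hγ : 0 ≤ γ) (hγq : γ + 2 ≤ q) (hfm : Measurable f)
    (hf : ∀ v, 0 ≤ f v) (hM₀ : (∫⁻ v, ENNReal.ofReal (f v)) ≤ ENNReal.ofReal M₀)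
    (hMq : MomentBound f q Mq) (hρ : 1 ≤ ρ) (hV : ‖V‖ ≤ 4 * ρ) :
    ‖landauB n γ f V‖ ≤ ρ ^ (γ + 1) * momentConst q M₀ Mq := by
  have hC : 0 ≤ ρ ^ (γ + 1) := Real.rpow_nonneg (by linarith) _
  have hB := momentConst_nonneg q M₀ Mq
  rw [← ENNReal.ofReal_le_ofReal_iff (by positivity), ofReal_norm]
  refine (enorm_integral_le_lintegral_enorm _).trans ?_
  have key := lintegral_kernel_mul_le (by linarith) hfm hf hM₀ hMq hC V
    fun w ↦ norm_rpow_le_mul_four_add_rpow hρ hV (by linarith : 0 ≤ γ + 1)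
      (by linarith : γ + 1 ≤ q) w
  refine le_trans (lintegral_mono fun w ↦ ?_) key
  rw [← ofReal_norm]
  apply ENNReal.ofReal_le_ofReal
  have := hf (V - w)
  rw [norm_smul, Real.norm_of_nonneg (by positivity),
    Real.rpow_add_one' (norm_nonneg _) (by linarith)]
  exact le_of_eq (by ring)

lemma landauQF_le (hγ : 0 ≤ γ) (hγq : γ + 2 ≤ q) (hfm : Measurable f) (hf : ∀ v, 0 ≤ f v)
    (hM₀ : (∫⁻ v, ENNReal.ofReal (f v)) ≤ ENNReal.ofReal M₀) (hMq : MomentBound f q Mq)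
    (hρ : 1 ≤ ρ) (hV : ‖V‖ ≤ 4 * ρ) {a : En n}
    (ha : ∀ w, ‖a‖ ^ 2 * ‖w‖ ^ 2 - ⟪w, a⟫ ^ 2 ≤ 4 * ρ ^ 2 * (4 + ‖V - w‖) ^ 2) :
    landauQF n γ f V a ≤ ENNReal.ofReal (4 * ρ ^ (γ + 2) * momentConst q M₀ Mq) := by
  have hρ0 : 0 < ρ := by linarith
  refine lintegral_kernel_mul_le (by linarith) hfm hf hM₀ hMq (by positivity) V fun w ↦ ?_
  have hs : 1 ≤ 4 + ‖V - w‖ := by linarith [norm_nonneg (V - w)]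
  rcases eq_or_ne w 0 with rfl | hw
  · rw [norm_zero, Real.zero_rpow (by linarith), mul_zero]
    positivity
  have hw' : 0 < ‖w‖ := norm_pos_iff.mpr hw
  calc (‖a‖ ^ 2 - ⟪w, a⟫ ^ 2 / ‖w‖ ^ 2) * ‖w‖ ^ (γ + 2)
      = (‖a‖ ^ 2 * ‖w‖ ^ 2 - ⟪w, a⟫ ^ 2) * ‖w‖ ^ γ := by
        rw [Real.rpow_add hw', Real.rpow_two]
        field_simp
    _ ≤ (4 * ρ ^ 2 * (4 + ‖V - w‖) ^ 2) * (ρ ^ γ * (4 + ‖V - w‖) ^ γ) :=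
        mul_le_mul (ha w) (norm_rpow_le_of_norm_le hρ hV hγ w) (by positivity) (by positivity)
    _ = 4 * ρ ^ (γ + 2) * (4 + ‖V - w‖) ^ (γ + 2) := by
        rw [Real.rpow_add hρ0, Real.rpow_add (by linarith), Real.rpow_two, Real.rpow_two]
        ring
    _ ≤ 4 * ρ ^ (γ + 2) * (4 + ‖V - w‖) ^ q := by
        gcongr

end Moments

section Gram

variable {E : Type*} [NormedAddCommGroup E] [InnerProductSpace ℝ E]

lemma norm_sq_mul_norm_sq_sub_inner_sq_nonneg (x w : E) :
    0 ≤ ‖x‖ ^ 2 * ‖w‖ ^ 2 - ⟪w, x⟫ ^ 2 := by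
  have h := sq_le_sq' (neg_le_of_abs_le (abs_real_inner_le_norm w x)) (real_inner_le_norm w x)
  nlinarith

lemma gram_add_le (x y w : E) :
    ‖x + y‖ ^ 2 * ‖w‖ ^ 2 - ⟪w, x + y⟫ ^ 2 ≤
      2 * (‖x‖ ^ 2 * ‖w‖ ^ 2 - ⟪w, x⟫ ^ 2) + 2 * (‖y‖ ^ 2 * ‖w‖ ^ 2 - ⟪w, y⟫ ^ 2) := by
  have h := norm_sq_mul_norm_sq_sub_inner_sq_nonneg (x - y) w
  rw [norm_sub_sq_real, inner_sub_right] at h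
  rw [norm_add_sq_real, inner_add_right]
  nlinarith

lemma gram_add_smul (x w : E) (t : ℝ) :
    ‖x‖ ^ 2 * ‖w + t • x‖ ^ 2 - ⟪w + t • x, x⟫ ^ 2 = ‖x‖ ^ 2 * ‖w‖ ^ 2 - ⟪w, x⟫ ^ 2 := by
  rw [norm_add_sq_real, inner_add_left, real_inner_smul_left, real_inner_smul_right, norm_smul,
    real_inner_self_eq_norm_sq, mul_pow, Real.norm_eq_abs, sq_abs]
  ring

end Gram

section Tau

variable {n : ℕ} {v₀ : En n}

lemma abs_inner_div_norm_sq_mul_norm_le (v₀ u : En n) :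
    |⟪u, v₀⟫ / ‖v₀‖ ^ 2| * ‖v₀‖ ≤ ‖u‖ := by
  rcases eq_or_ne v₀ 0 with rfl | h0
  · simp
  have h0' : 0 < ‖v₀‖ := norm_pos_iff.mpr h0
  rw [abs_div, abs_of_nonneg (sq_nonneg ‖v₀‖), div_mul_eq_mul_div, div_le_iff₀ (by positivity)]
  nlinarith [abs_real_inner_le_norm u v₀]

lemma norm_tau0_le (h : 2 ≤ ‖v₀‖) (u : En n) : ‖tau0 v₀ u‖ ≤ 2 * ‖u‖ := by
  have h1 : |1 / ‖v₀‖ - 1| ≤ 1 := by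
    have : 1 / ‖v₀‖ ≤ 1 := by rw [div_le_one (by linarith)]; linarith
    have : 0 ≤ 1 / ‖v₀‖ := by positivity
    rw [abs_le]; constructor <;> linarith
  rw [tau0, if_pos h]
  refine (norm_add_le _ _).trans ?_
  rw [norm_smul, Real.norm_eq_abs, abs_mul, mul_assoc]
  have := mul_le_mul h1 (abs_inner_div_norm_sq_mul_norm_le v₀ u) (by positivity) zero_le_one
  linarith

lemma norm_tau0inv_le (h : 2 ≤ ‖v₀‖) (u : En n) : ‖tau0inv v₀ u‖ ≤ ‖v₀‖ * ‖u‖ := by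
  rw [tau0inv, if_pos h]
  refine (norm_add_le _ _).trans ?_
  rw [norm_smul, Real.norm_eq_abs, abs_mul, mul_assoc, abs_of_nonneg (by linarith)]
  have := mul_le_mul_of_nonneg_left (abs_inner_div_norm_sq_mul_norm_le v₀ u)
    (by linarith : 0 ≤ ‖v₀‖ - 1)
  linarith

/-- The anisotropic gain: `τ₀⁻¹` stretches the direction of `v₀`, in which the projection onto
`w^⊥` is small for `w` close to `v₀`. -/
lemma gram_tau0inv_le (h : 2 ≤ ‖v₀‖) {v e : En n} (hv : ‖v‖ < 2) (he : ‖e‖ = 1)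
    (hV : ‖v₀ + tau0 v₀ v‖ ≤ 4 * ‖v₀‖) (w : En n) :
    ‖tau0inv v₀ e‖ ^ 2 * ‖w‖ ^ 2 - ⟪w, tau0inv v₀ e⟫ ^ 2 ≤
      4 * ‖v₀‖ ^ 2 * (4 + ‖v₀ + tau0 v₀ v - w‖) ^ 2 := by
  set z := v₀ + tau0 v₀ v - w with hz
  have hr : 0 < ‖v₀‖ := by linarith
  obtain ⟨c, hc, hce⟩ : ∃ c : ℝ, |c| ≤ 1 ∧ tau0inv v₀ e = e + c • v₀ := by
    refine ⟨(‖v₀‖ - 1) * (⟪e, v₀⟫ / ‖v₀‖ ^ 2), ?_, by rw [tau0inv, if_pos h]⟩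
    have h1 := abs_inner_div_norm_sq_mul_norm_le v₀ e
    rw [abs_mul, abs_of_nonneg (by linarith : 0 ≤ ‖v₀‖ - 1)]
    nlinarith [abs_nonneg (⟪e, v₀⟫ / ‖v₀‖ ^ 2)]
  obtain ⟨t, ht⟩ : ∃ t : ℝ, w = v - z + t • v₀ := by
    refine ⟨1 + (1 / ‖v₀‖ - 1) * (⟪v, v₀⟫ / ‖v₀‖ ^ 2), ?_⟩
    rw [hz, tau0, if_pos h]
    module
  have hw : ‖w‖ ≤ ‖v₀‖ * (4 + ‖z‖) := by
    simpa using norm_rpow_le_of_norm_le (s := 1) (by linarith) hV zero_le_one w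
  have hvz : ‖v - z‖ ≤ 4 + ‖z‖ := (norm_sub_le _ _).trans (by linarith)
  have h1 : ‖e‖ ^ 2 * ‖w‖ ^ 2 - ⟪w, e⟫ ^ 2 ≤ (‖v₀‖ * (4 + ‖z‖)) ^ 2 := by
    rw [he]
    nlinarith [pow_le_pow_left₀ (norm_nonneg w) hw 2, sq_nonneg ⟪w, e⟫]
  have h2 : ‖v₀‖ ^ 2 * ‖w‖ ^ 2 - ⟪w, v₀⟫ ^ 2 ≤ (‖v₀‖ * (4 + ‖z‖)) ^ 2 := by
    rw [ht, gram_add_smul, mul_pow]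
    have := mul_le_mul_of_nonneg_left (pow_le_pow_left₀ (norm_nonneg _) hvz 2)
      (sq_nonneg ‖v₀‖)
    nlinarith [sq_nonneg ⟪v - z, v₀⟫]
  have h3 : ‖c • v₀‖ ^ 2 * ‖w‖ ^ 2 - ⟪w, c • v₀⟫ ^ 2 ≤
      ‖v₀‖ ^ 2 * ‖w‖ ^ 2 - ⟪w, v₀⟫ ^ 2 := by
    have hG := norm_sq_mul_norm_sq_sub_inner_sq_nonneg v₀ w
    have hc2 : c ^ 2 ≤ 1 := (sq_le_one_iff_abs_le_one c).mpr hc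
    rw [norm_smul, real_inner_smul_right, mul_pow, Real.norm_eq_abs, sq_abs]
    nlinarith
  rw [hce]
  calc _ ≤ _ := gram_add_le e (c • v₀) w
    _ ≤ 2 * (‖v₀‖ * (4 + ‖z‖)) ^ 2 + 2 * (‖v₀‖ * (4 + ‖z‖)) ^ 2 := by gcongr; exact h3.trans h2
    _ = 4 * ‖v₀‖ ^ 2 * (4 + ‖z‖) ^ 2 := by ring

end Tau

/-- Lemma 7.2 of the paper: upper bounds for the transformed Landau
coefficients. If `∫ f ≤ M₀` and `∫ f |v|^q ≤ M_q` with `q ≥ 2`, `γ ≥ 0`, `γ+2 ∈ [0,q]`, then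
for every `v₀ ∈ ℝⁿ` and `v ∈ B₂`: (a) `sup_{|e|=1} e·Ã(v)e ≤ Λ`; (b) `|b̃(v)| ≤ Λ`;
(c) `|c̃(v)| ≤ Λ (1+|v₀|)^{-2}`, with `Λ` depending only on `n, M₀, M_q, q`
(independent of `v₀` and `γ`). -/
theorem stmt19 (n : ℕ) (hn : 2 ≤ n) (q M₀ Mq : ℝ) (hq : 2 ≤ q) :
    ∃ Lam : ℝ, 0 < Lam ∧
      ∀ γ : ℝ, 0 ≤ γ → γ + 2 ≤ q →
        ∀ f : En n → ℝ, Measurable f → (∀ v, 0 ≤ f v) →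
          (∫⁻ v, ENNReal.ofReal (f v)) ≤ ENNReal.ofReal M₀ →
          MomentBound f q Mq →
          ∀ (v₀ v : En n), ‖v‖ < 2 →
            (∀ e : En n, ‖e‖ = 1 → landauQFtilde n γ f v₀ v e ≤ ENNReal.ofReal Lam) ∧
            ‖landauBtilde n γ f v₀ v‖ ≤ Lam ∧
            landauCtilde n γ f v₀ v ≤ ENNReal.ofReal (Lam * (1 + ‖v₀‖) ^ (-2 : ℝ)) := by
  have hB := momentConst_nonneg q M₀ Mq
  refine ⟨36 * momentConst q M₀ Mq + 1, by positivity, ?_⟩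
  set B := momentConst q M₀ Mq with hBdef
  intro γ hγ hγq f hfm hf hM₀ hMq v₀ v hv
  have h1r : 0 < 1 + ‖v₀‖ := by positivity
  by_cases h : 2 ≤ ‖v₀‖
  · have hr : 0 < ‖v₀‖ := by linarith
    have hV : ‖v₀ + tau0 v₀ v‖ ≤ 4 * ‖v₀‖ :=
      (norm_add_le _ _).trans (by linarith [norm_tau0_le h v])
    have hR : 0 ≤ ‖v₀‖ ^ (-γ - 2) := by positivity
    refine ⟨fun e he ↦ ?_, ?_, ?_⟩
    · rw [landauQFtilde, if_pos h]
      refine (mul_le_mul_right (landauQF_le hγ hγq hfm hf hM₀ hMq (by linarith) hV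
        (gram_tau0inv_le h hv he hV)) _).trans ?_
      rw [← ENNReal.ofReal_mul hR]
      apply ENNReal.ofReal_le_ofReal
      have : ‖v₀‖ ^ (-γ - 2) * ‖v₀‖ ^ (γ + 2) = 1 := by
        rw [← Real.rpow_add hr, show -γ - 2 + (γ + 2) = 0 by ring, Real.rpow_zero]
      calc ‖v₀‖ ^ (-γ - 2) * (4 * ‖v₀‖ ^ (γ + 2) * B)
          = 4 * B * (‖v₀‖ ^ (-γ - 2) * ‖v₀‖ ^ (γ + 2)) := by ring
        _ ≤ 36 * B + 1 := by rw [this]; linarith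
    · rw [landauBtilde, if_pos h, norm_smul, Real.norm_of_nonneg hR]
      have hb := norm_landauB_le hγ hγq hfm hf hM₀ hMq (by linarith) hV
      have : ‖v₀‖ ^ (-γ - 2) * (‖v₀‖ * ‖v₀‖ ^ (γ + 1)) = 1 := by
        rw [← Real.rpow_one_add' hr.le (by linarith), ← Real.rpow_add hr,
          show -γ - 2 + (1 + (γ + 1)) = 0 by ring, Real.rpow_zero]
      calc ‖v₀‖ ^ (-γ - 2) * ‖tau0inv v₀ (landauB n γ f (v₀ + tau0 v₀ v))‖
          ≤ ‖v₀‖ ^ (-γ - 2) * (‖v₀‖ * (‖v₀‖ ^ (γ + 1) * B)) := by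
            gcongr
            exact (norm_tau0inv_le h _).trans (by gcongr)
        _ = B * (‖v₀‖ ^ (-γ - 2) * (‖v₀‖ * ‖v₀‖ ^ (γ + 1))) := by ring
        _ ≤ 36 * B + 1 := by rw [this]; linarith
    · rw [landauCtilde, if_pos h]
      refine (mul_le_mul_right (landauC_le hγ hγq hfm hf hM₀ hMq (by linarith) hV) _).trans ?_
      rw [← ENNReal.ofReal_mul hR]
      apply ENNReal.ofReal_le_ofReal
      rw [← mul_assoc, ← Real.rpow_add hr, show -γ - 2 + γ = -2 by ring,
        Real.rpow_neg hr.le, Real.rpow_neg h1r.le, Real.rpow_two, Real.rpow_two,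
        inv_mul_eq_div, ← div_eq_mul_inv, div_le_div_iff₀ (by positivity) (by positivity)]
      have : (1 + ‖v₀‖) ^ 2 ≤ 4 * ‖v₀‖ ^ 2 := by nlinarith
      nlinarith [mul_le_mul_of_nonneg_left this hB, mul_nonneg hB (sq_nonneg ‖v₀‖)]
  · push Not at h
    have hV : ‖v₀ + v‖ ≤ 4 * 1 := (norm_add_le _ _).trans (by linarith)
    refine ⟨fun e he ↦ ?_, ?_, ?_⟩
    · rw [landauQFtilde, if_neg h.not_ge]
      refine (landauQF_le hγ hγq hfm hf hM₀ hMq le_rfl hV fun w ↦ ?_).trans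
        (ENNReal.ofReal_le_ofReal ?_)
      · have hw : ‖w‖ ≤ 4 + ‖v₀ + v - w‖ := by
          simpa using norm_rpow_le_of_norm_le (s := 1) le_rfl hV zero_le_one w
        rw [he]
        nlinarith [pow_le_pow_left₀ (norm_nonneg w) hw 2, sq_nonneg ⟪w, e⟫]
      · rw [Real.one_rpow]; linarith
    · rw [landauBtilde, if_neg h.not_ge]
      refine (norm_landauB_le hγ hγq hfm hf hM₀ hMq le_rfl hV).trans ?_
      rw [Real.one_rpow]; linarith
    · rw [landauCtilde, if_neg h.not_ge]
      refine (landauC_le hγ hγq hfm hf hM₀ hMq le_rfl hV).trans (ENNReal.ofReal_le_ofReal ?_)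
      rw [Real.one_rpow, one_mul, Real.rpow_neg h1r.le, Real.rpow_two, ← div_eq_mul_inv,
        le_div_iff₀ (by positivity)]
      have : (1 + ‖v₀‖) ^ 2 ≤ 9 := by nlinarith [norm_nonneg v₀]
      nlinarith [mul_le_mul_of_nonneg_left this hB]
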